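/- Fix an integer r ≥ 1. The spectral sequence {E^{p,q}_r} induced by the double complex A degenerates at E_r but not at E_{r-1} (i.e. d_s = 0 for all integers p, q and all s ≥ r, while d_{r-1} ≠ 0 for some p, q) if and only if both of the following hold: (1) ℰ^{p,q}_k = ∅ for all integers p, q and all integers k ≥ r, and (2) ℰ^{p,q}_{r-1} ≠ ∅ for some integers p, q. -/

import Mathlib

open Submodule

/-- A double complex of `k`-vector spaces: `A = ⊕_{p,q ∈ ℤ} A^{p,q}` with `A^{p,q} = 0`
for `p < 0` or `q < 0`, with anticommuting differentials `d' : A^{p,q} → A^{p+1,q}` and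
`d'' : A^{p,q} → A^{p,q+1}` squaring to zero. -/
structure DoubleComplex (k : Type*) [Field k] (V : Type*) [AddCommGroup V] [Module k V] where
  A : ℤ → ℤ → Submodule k V
  isInternal : DirectSum.IsInternal (fun pq : ℤ × ℤ => A pq.1 pq.2)
  vanish : ∀ p q : ℤ, p < 0 ∨ q < 0 → A p q = ⊥
  d' : V →ₗ[k] V
  d'' : V →ₗ[k] V
  mapA_d' : ∀ p q : ℤ, (A p q).map d' ≤ A (p + 1) q
  mapA_d'' : ∀ p q : ℤ, (A p q).map d'' ≤ A p (q + 1)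
  d'_d' : d' ∘ₗ d' = 0
  d''_d'' : d'' ∘ₗ d'' = 0
  anticomm : d' ∘ₗ d'' + d'' ∘ₗ d' = 0

namespace DoubleComplex

variable {k : Type*} [Field k] {V : Type*} [AddCommGroup V] [Module k V]
variable (C : DoubleComplex k V)

/-- The total differential `d = d' + d''`. -/
def dTot : V →ₗ[k] V := C.d' + C.d''

lemma dd_apply (x : V) : C.dTot (C.dTot x) = 0 := by
  have h1 := LinearMap.ext_iff.mp C.d'_d' x
  have h2 := LinearMap.ext_iff.mp C.d''_d'' x
  have h3 := LinearMap.ext_iff.mp C.anticomm x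
  simp only [LinearMap.comp_apply, LinearMap.zero_apply, LinearMap.add_apply] at h1 h2 h3
  simp only [dTot, LinearMap.add_apply, map_add]
  rw [h1, h2, zero_add, add_zero, add_comm]
  exact h3

/-- The filtration `F^p A^n = ⊕_{s ≥ p} A^{s, n-s}`. -/
def F (p n : ℤ) : Submodule k V := ⨆ (s : ℤ) (_ : p ≤ s), C.A s (n - s)

lemma F_antitone {p p' : ℤ} (h : p ≤ p') (n : ℤ) : C.F p' n ≤ C.F p n :=
  biSup_mono fun s hs => le_trans h hs

/-- `Z^{p,q}_r = {ξ ∈ F^p A^{p+q} : dξ ∈ F^{p+r} A^{p+q+1}}`. -/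
def Z (p q r : ℤ) : Submodule k V :=
  C.F p (p + q) ⊓ (C.F (p + r) (p + q + 1)).comap C.dTot

/-- `Z^{p,q}_∞ = F^p A^{p+q} ∩ ker d`. -/
def Zinf (p q : ℤ) : Submodule k V := C.F p (p + q) ⊓ LinearMap.ker C.dTot

/-- `B^{p,q}_r = F^p A^{p+q} ∩ d(F^{p-r} A^{p+q-1})`. -/
def B (p q r : ℤ) : Submodule k V :=
  C.F p (p + q) ⊓ (C.F (p - r) (p + q - 1)).map C.dTot

/-- `B^{p,q}_∞ = F^p A^{p+q} ∩ im d`. -/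
def Binf (p q : ℤ) : Submodule k V := C.F p (p + q) ⊓ LinearMap.range C.dTot

lemma B_mono (p q : ℤ) {r r' : ℤ} (h : r ≤ r') : C.B p q r ≤ C.B p q r' :=
  inf_le_inf le_rfl (Submodule.map_mono (C.F_antitone (by omega) _))

lemma Z_anti (p q : ℤ) {r r' : ℤ} (h : r' ≤ r) : C.Z p q r ≤ C.Z p q r' :=
  inf_le_inf le_rfl (Submodule.comap_mono (C.F_antitone (by omega) _))

/-- The denominator `Z^{p+1,q-1}_{r-1} + B^{p,q}_{r-1}` of `E^{p,q}_r`. -/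
def Eden (p q r : ℤ) : Submodule k V := C.Z (p + 1) (q - 1) (r - 1) ⊔ C.B p q (r - 1)

/-- `E^{p,q}_r = Z^{p,q}_r / (Z^{p+1,q-1}_{r-1} + B^{p,q}_{r-1})`. -/
abbrev E (p q r : ℤ) :=
  C.Z p q r ⧸ (C.Eden p q r).comap (C.Z p q r).subtype

/-- The common target `Z^{p,q}_r / (Z^{p+1,q-1}_{r-1} + B^{p,q}_r)` of `α_{p,q,r}` and
`β_{p,q,r}`. -/
abbrev T (p q r : ℤ) :=
  C.Z p q r ⧸ (C.Z (p + 1) (q - 1) (r - 1) ⊔ C.B p q r).comap (C.Z p q r).subtype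

/-- `β_{p,q,r} : E^{p,q}_r → Z^{p,q}_r/(Z^{p+1,q-1}_{r-1} + B^{p,q}_r)`, induced by the
identity of `Z^{p,q}_r`. -/
def beta (p q r : ℤ) : C.E p q r →ₗ[k] C.T p q r :=
  Submodule.mapQ _ _ LinearMap.id (by
    intro x hx
    simp only [Submodule.mem_comap, LinearMap.id_coe, id_eq] at hx ⊢
    exact sup_le_sup_left (C.B_mono p q (by omega)) _ hx)

/-- `α_{p,q,r} : E^{p,q}_{r+1} → Z^{p,q}_r/(Z^{p+1,q-1}_{r-1} + B^{p,q}_r)`, induced by the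
inclusion `Z^{p,q}_{r+1} ⊆ Z^{p,q}_r`. -/
def alpha (p q r : ℤ) : C.E p q (r + 1) →ₗ[k] C.T p q r :=
  Submodule.mapQ _ _ (Submodule.inclusion (C.Z_anti p q (by omega : r ≤ r + 1))) (by
    rw [← Submodule.comap_comp, Submodule.subtype_comp_inclusion]
    exact Submodule.comap_mono
      (sup_le_sup (C.Z_anti _ _ (by omega)) (C.B_mono _ _ (by omega))))

lemma d_Z (p q r : ℤ) : ∀ x ∈ C.Z p q r, C.dTot x ∈ C.Z (p + r) (q - r + 1) r := by
  intro x hx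
  rw [Z, Submodule.mem_inf] at hx ⊢
  obtain ⟨hx1, hx2⟩ := hx
  constructor
  · rw [show p + r + (q - r + 1) = p + q + 1 by ring]
    exact hx2
  · rw [Submodule.mem_comap, C.dd_apply]
    exact zero_mem _

lemma d_Eden (p q r : ℤ) : ∀ x ∈ C.Eden p q r, C.dTot x ∈ C.Eden (p + r) (q - r + 1) r := by
  intro x hx
  rw [Eden, Submodule.mem_sup] at hx
  obtain ⟨y, hy, z, hz, rfl⟩ := hx
  rw [map_add]
  apply add_mem
  · apply Submodule.mem_sup_right
    rw [Z, Submodule.mem_inf] at hy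
    obtain ⟨hy1, hy2⟩ := hy
    rw [Submodule.mem_comap] at hy2
    rw [B, Submodule.mem_inf]
    have e1 : (p + 1 + (r - 1) : ℤ) = p + r := by ring
    have e2 : (p + 1 + (q - 1) + 1 : ℤ) = p + r + (q - r + 1) := by ring
    have e3 : (p + 1 + (q - 1) : ℤ) = p + r + (q - r + 1) - 1 := by ring
    rw [e1, e2] at hy2
    rw [e3] at hy1
    refine ⟨hy2, ?_⟩
    rw [show (p + r - (r - 1) : ℤ) = p + 1 by ring]
    exact Submodule.mem_map_of_mem hy1
  · rw [B, Submodule.mem_inf] at hz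
    obtain ⟨hz1, hz2⟩ := hz
    rw [Submodule.mem_map] at hz2
    obtain ⟨w, hw, rfl⟩ := hz2
    rw [C.dd_apply]
    exact zero_mem _

/-- The restriction of the total differential to `Z^{p,q}_r → Z^{p+r,q-r+1}_r`. -/
def drAux (p q r : ℤ) : C.Z p q r →ₗ[k] C.Z (p + r) (q - r + 1) r :=
  C.dTot.restrict (C.d_Z p q r)

/-- The induced differential `d_r : E^{p,q}_r → E^{p+r,q-r+1}_r`. -/
def dr (p q r : ℤ) : C.E p q r →ₗ[k] C.E (p + r) (q - r + 1) r :=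
  Submodule.mapQ _ _ (C.drAux p q r) (by
    rw [drAux, ← Submodule.comap_comp, LinearMap.subtype_comp_restrict]
    show (C.Eden p q r).comap (C.Z p q r).subtype ≤
      (C.Eden (p + r) (q - r + 1) r).comap (C.dTot ∘ₗ (C.Z p q r).subtype)
    rw [Submodule.comap_comp]
    exact Submodule.comap_mono fun x hx => C.d_Eden p q r x hx)

/-- The set `ℰ^{p,q}_r`: for `r ≥ 1` it consists of the elements
`ξ = ξ_0 + ⋯ + ξ_{r-1}` with `ξ_i ∈ A^{p+i,q-i}` such that `dξ = d'ξ_{r-1}`,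
`d'ξ_{r-1} ∉ im d''`, and `ξ_0` is not the leading term of any `d`-closed element
(no `d`-closed `η ∈ F^p A^{p+q}` has component `ξ_0` in `A^{p,q}`, i.e. `η - ξ_0 ∈ F^{p+1}`);
and `ℰ^{p,q}_0 = B^{p,q+1}_0 \ (Z^{p+1,q}_{-1} + B^{p,q+1}_{-1})`. -/
def scrE (p q r : ℤ) : Set V :=
  if 1 ≤ r then
    {ξ | ∃ c : ℕ → V, (∀ i : ℕ, c i ∈ C.A (p + i) (q - i)) ∧
        ξ = ∑ i ∈ Finset.range r.toNat, c i ∧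
        C.dTot ξ = C.d' (c (r.toNat - 1)) ∧
        C.d' (c (r.toNat - 1)) ∉ LinearMap.range C.d'' ∧
        ¬∃ η, η ∈ C.F p (p + q) ∧ C.dTot η = 0 ∧ η - c 0 ∈ C.F (p + 1) (p + q)}
  else
    (C.B p (q + 1) 0 : Set V) \ ((C.Z (p + 1) q (-1) ⊔ C.B p (q + 1) (-1) : Submodule k V) : Set V)

/-- The double complex satisfies the `d'd''`-lemma:
`im d' ∩ ker d'' ∩ A^{p,q} = ker d' ∩ im d'' ∩ A^{p,q} = im (d'd'') ∩ A^{p,q}` for all `p, q`. -/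
def DDLemma : Prop :=
  ∀ p q : ℤ,
    LinearMap.range C.d' ⊓ LinearMap.ker C.d'' ⊓ C.A p q
        = LinearMap.ker C.d' ⊓ LinearMap.range C.d'' ⊓ C.A p q ∧
      LinearMap.range C.d' ⊓ LinearMap.ker C.d'' ⊓ C.A p q
        = LinearMap.range (C.d' ∘ₗ C.d'') ⊓ C.A p q

lemma d'_mem {p q : ℤ} {x : V} (hx : x ∈ C.A p q) : C.d' x ∈ C.A (p + 1) q :=
  C.mapA_d' p q (mem_map_of_mem hx)

lemma d''_mem {p q : ℤ} {x : V} (hx : x ∈ C.A p q) : C.d'' x ∈ C.A p (q + 1) :=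
  C.mapA_d'' p q (mem_map_of_mem hx)

lemma mem_Z {p q r : ℤ} {x : V} :
    x ∈ C.Z p q r ↔ x ∈ C.F p (p + q) ∧ C.dTot x ∈ C.F (p + r) (p + q + 1) :=
  Iff.rfl

lemma mem_B {p q r : ℤ} {x : V} :
    x ∈ C.B p q r ↔ x ∈ C.F p (p + q) ∧ ∃ w ∈ C.F (p - r) (p + q - 1), C.dTot w = x :=
  Iff.rfl

lemma A_le_F {p s t n : ℤ} (hs : p ≤ s) (hn : s + t = n) : C.A s t ≤ C.F p n := by
  obtain rfl : t = n - s := by omega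
  exact le_iSup₂_of_le s hs le_rfl

lemma F_eq_bot {p n : ℤ} (h : n < p) : C.F p n = ⊥ := by
  rw [F, iSup₂_eq_bot]
  intro s hs
  exact C.vanish _ _ (Or.inr (by omega))

/-- The projection of the double complex onto its component `A^{p,q}`. -/
noncomputable def proj (p q : ℤ) : V →ₗ[k] V :=
  (C.A p q).subtype ∘ₗ DirectSum.component k (ℤ × ℤ) (fun pq => C.A pq.1 pq.2) (p, q) ∘ₗ
    (LinearEquiv.ofBijective (DirectSum.coeLinearMap fun pq : ℤ × ℤ => C.A pq.1 pq.2)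
      C.isInternal).symm.toLinearMap

lemma proj_mem (p q : ℤ) (x : V) : C.proj p q x ∈ C.A p q := by
  simp [proj]

lemma symm_coeLinearMap_of_mem {p q : ℤ} {x : V} (hx : x ∈ C.A p q) :
    (LinearEquiv.ofBijective (DirectSum.coeLinearMap fun pq : ℤ × ℤ => C.A pq.1 pq.2)
      C.isInternal).symm x =
      DirectSum.lof k (ℤ × ℤ) (fun pq => C.A pq.1 pq.2) (p, q) ⟨x, hx⟩ := by
  rw [LinearEquiv.symm_apply_eq]
  exact (DirectSum.coeLinearMap_lof (fun pq : ℤ × ℤ => C.A pq.1 pq.2) (p, q) ⟨x, hx⟩).symm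

lemma proj_of_mem {p q : ℤ} {x : V} (hx : x ∈ C.A p q) : C.proj p q x = x := by
  simp only [proj, LinearMap.comp_apply, LinearEquiv.coe_coe, C.symm_coeLinearMap_of_mem hx]
  rw [DirectSum.component.lof_self]
  rfl

lemma proj_of_mem_of_ne {p q s t : ℤ} {x : V} (hx : x ∈ C.A s t) (h : ¬(s = p ∧ t = q)) :
    C.proj p q x = 0 := by
  simp only [proj, LinearMap.comp_apply, LinearEquiv.coe_coe, C.symm_coeLinearMap_of_mem hx]
  rw [DirectSum.component.of, dif_neg (by simpa [Prod.ext_iff] using h)]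
  simp

lemma iSup_A : ⨆ pq : ℤ × ℤ, C.A pq.1 pq.2 = ⊤ := C.isInternal.submodule_iSup_eq_top

/-- Two linear maps which agree on all components `A^{p,q}` are equal. -/
lemma eq_of_eqOn_A {f g : V →ₗ[k] V} (h : ∀ p q : ℤ, ∀ x ∈ C.A p q, f x = g x) (x : V) :
    f x = g x := by
  have : (⊤ : Submodule k V) ≤ LinearMap.eqLocus f g := by
    rw [← C.iSup_A]
    exact iSup_le fun pq y hy => h _ _ y hy
  exact this mem_top

lemma proj_d' (p q : ℤ) (x : V) : C.proj (p + 1) q (C.d' x) = C.d' (C.proj p q x) := by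
  refine C.eq_of_eqOn_A (f := C.proj (p + 1) q ∘ₗ C.d') (g := C.d' ∘ₗ C.proj p q)
    (fun s t y hy => ?_) x
  by_cases h : s = p ∧ t = q
  · obtain ⟨rfl, rfl⟩ := h
    simp [C.proj_of_mem hy, C.proj_of_mem (C.d'_mem hy)]
  · have h' : ¬(s + 1 = p + 1 ∧ t = q) := by omega
    simp [C.proj_of_mem_of_ne hy h, C.proj_of_mem_of_ne (C.d'_mem hy) h']

lemma proj_d'' (p q : ℤ) (x : V) : C.proj p (q + 1) (C.d'' x) = C.d'' (C.proj p q x) := by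
  refine C.eq_of_eqOn_A (f := C.proj p (q + 1) ∘ₗ C.d'') (g := C.d'' ∘ₗ C.proj p q)
    (fun s t y hy => ?_) x
  by_cases h : s = p ∧ t = q
  · obtain ⟨rfl, rfl⟩ := h
    simp [C.proj_of_mem hy, C.proj_of_mem (C.d''_mem hy)]
  · have h' : ¬(s = p ∧ t + 1 = q + 1) := by omega
    simp [C.proj_of_mem_of_ne hy h, C.proj_of_mem_of_ne (C.d''_mem hy) h']

lemma proj_of_mem_F {p n s t : ℤ} {x : V} (hx : x ∈ C.F p n) (hs : s < p) :
    C.proj s t x = 0 := by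
  have : C.F p n ≤ LinearMap.ker (C.proj s t) :=
    iSup₂_le fun u hu y hy => C.proj_of_mem_of_ne hy (by omega)
  exact this hx

lemma sub_proj_mem_F {p q : ℤ} {x : V} (hx : x ∈ C.F p (p + q)) :
    x - C.proj p q x ∈ C.F (p + 1) (p + q) := by
  have : C.F p (p + q) ≤ (C.F (p + 1) (p + q)).comap (LinearMap.id - C.proj p q) := by
    refine iSup₂_le fun u hu y hy => ?_
    simp only [mem_comap, LinearMap.sub_apply, LinearMap.id_apply]
    by_cases h : u = p
    · subst h
      rw [add_sub_cancel_left] at hy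
      simp [C.proj_of_mem hy]
    · rw [C.proj_of_mem_of_ne hy (by omega), sub_zero]
      exact C.A_le_F (by omega) (by omega) hy
  exact this hx

/-- The differential `d_s` vanishes on `E^{p,q}_s` if and only if every element of `Z^{p,q}_s`
has the same leading term as some element of `Z^{p,q}_{s+1}`. -/
lemma dr_eq_zero_iff (p q s : ℤ) :
    C.dr p q s = 0 ↔
      ∀ x ∈ C.Z p q s, ∃ y ∈ C.Z p q (s + 1), y - x ∈ C.F (p + 1) (p + q) := by
  have key : C.dr p q s = 0 ↔
      ∀ x ∈ C.Z p q s, C.dTot x ∈ C.Eden (p + s) (q - s + 1) s := by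
    constructor
    · intro h x hx
      have h1 := LinearMap.congr_fun h (Submodule.Quotient.mk ⟨x, hx⟩)
      rw [dr, mapQ_apply, LinearMap.zero_apply, Submodule.Quotient.mk_eq_zero] at h1
      exact h1
    · intro h
      refine LinearMap.ext fun z => ?_
      obtain ⟨⟨x, hx⟩, rfl⟩ := Submodule.Quotient.mk_surjective _ z
      rw [dr, mapQ_apply, LinearMap.zero_apply, Submodule.Quotient.mk_eq_zero]
      exact h x hx
  rw [key]
  refine forall₂_congr fun x hx => ?_
  have e1 : p + s + 1 + (q - s) = p + q + 1 := by ring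
  have e2 : p + s + (q - s + 1) = p + q + 1 := by ring
  have e4 : p + s - (s - 1) = p + 1 := by ring
  have e5 : p + (s + 1) = p + s + 1 := by ring
  rw [mem_Z] at hx
  simp only [Eden, mem_sup, mem_Z, mem_B, e1, e2, add_sub_cancel_right, e4, e5]
  constructor
  · rintro ⟨y, ⟨hy, -⟩, v, ⟨-, w, hw, hwv⟩, h⟩
    refine ⟨x - w, ⟨sub_mem hx.1 (C.F_antitone (by omega) _ hw), ?_⟩, by simpa using hw⟩
    rwa [map_sub, ← h, hwv, add_sub_cancel_right]
  · rintro ⟨y, ⟨-, hdy⟩, hyx⟩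
    refine ⟨C.dTot y, ⟨hdy, by rw [C.dd_apply]; exact zero_mem _⟩, C.dTot (x - y),
      ⟨?_, x - y, by rw [← neg_sub]; exact neg_mem hyx, rfl⟩, by simp⟩
    rw [map_sub]
    exact sub_mem hx.2 (C.F_antitone (by omega) _ hdy)

/-- If the spectral sequence degenerates at `E_s` at the spot `(p, q)`, then
`ℰ^{p,q}_s` is empty. -/
lemma scrE_eq_empty_of_dr_eq_zero {p q s : ℤ} (hs : 1 ≤ s)
    (h : ∀ t, s ≤ t → C.dr p q t = 0) : C.scrE p q s = ∅ := by
  rw [scrE, if_pos hs, Set.eq_empty_iff_forall_notMem]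
  rintro ξ ⟨c, hc, hξ, hdξ, -, hno⟩
  obtain ⟨n, rfl⟩ : ∃ n : ℕ, s = n + 1 := ⟨(s - 1).toNat, by omega⟩
  have hn : ((n : ℤ) + 1).toNat = n + 1 := by omega
  rw [hn, Nat.add_sub_cancel] at hdξ
  rw [hn, Finset.sum_range_succ'] at hξ
  have hc0 : c 0 ∈ C.F p (p + q) := C.A_le_F (by simp) (by simp) (hc 0)
  have hlead : ξ - c 0 ∈ C.F (p + 1) (p + q) := by
    rw [hξ, add_sub_cancel_right]
    exact sum_mem fun i _ => C.A_le_F (by push_cast; omega) (by ring) (hc (i + 1))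
  have hξF : ξ ∈ C.F p (p + q) := by
    rw [← sub_add_cancel ξ (c 0)]
    exact add_mem (C.F_antitone (by omega) _ hlead) hc0
  have hξZ : ξ ∈ C.Z p q (n + 1) := by
    rw [mem_Z, hdξ]
    refine ⟨hξF, ?_⟩
    exact C.A_le_F (by omega) (by ring) (C.d'_mem (hc n))
  have lift : ∀ m : ℕ, ∃ y ∈ C.Z p q (n + 1 + m), y - ξ ∈ C.F (p + 1) (p + q) := by
    intro m
    induction m with
    | zero => exact ⟨ξ, by simpa using hξZ, by simp⟩
    | succ m ih =>
      obtain ⟨y, hy, hyξ⟩ := ih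
      obtain ⟨z, hz, hzy⟩ := (C.dr_eq_zero_iff p q _).1 (h (n + 1 + m) (by omega)) y hy
      refine ⟨z, by push_cast; rwa [← add_assoc], ?_⟩
      rw [← sub_add_sub_cancel z y ξ]
      exact add_mem hzy hyξ
  obtain ⟨y, hy, hyξ⟩ := lift (q + 1).toNat
  obtain ⟨hyF, hyd⟩ := C.mem_Z.1 hy
  refine hno ⟨y, hyF, ?_, ?_⟩
  · have hF : C.F (p + (n + 1 + (q + 1).toNat)) (p + q + 1) = ⊥ := C.F_eq_bot (by omega)
    rwa [hF, mem_bot] at hyd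
  · rw [← sub_add_sub_cancel y ξ (c 0)]
    exact add_mem hyξ hlead

/-- If `ξ ∈ Z^{p,q}_s` with `s > m`, then the truncation of `ξ` to its first `m + 1` components
satisfies `d (ξ_0 + ⋯ + ξ_m) = d' ξ_m`. -/
lemma dTot_sum_proj {p q s : ℤ} {x : V} (hx : x ∈ C.Z p q s) (m : ℕ) (hm : (m : ℤ) < s) :
    C.dTot (∑ i ∈ Finset.range (m + 1), C.proj (p + i) (q - i) x) =
      C.d' (C.proj (p + m) (q - m) x) := by
  obtain ⟨hxF, hxd⟩ := C.mem_Z.1 hx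
  have hcomp : ∀ i : ℤ, i < s →
      C.d' (C.proj (p + i - 1) (q - i + 1) x) + C.d'' (C.proj (p + i) (q - i) x) = 0 := by
    intro i hi
    have h0 := C.proj_of_mem_F (s := p + i) (t := q - i + 1) hxd (by omega)
    rwa [dTot, LinearMap.add_apply, map_add, proj_d'',
      show p + i = p + i - 1 + 1 by ring, proj_d', sub_add_cancel] at h0
  induction m with
  | zero =>
    have h0 := hcomp 0 (by simpa using hm)
    rw [C.proj_of_mem_F hxF (by omega), map_zero, zero_add] at h0
    simp only [add_zero, sub_zero] at h0
    simp [dTot, h0]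
  | succ m ih =>
    have h0 := hcomp (m + 1 : ℕ) hm
    rw [show p + ((m + 1 : ℕ) : ℤ) - 1 = p + m by push_cast; ring,
      show q - ((m + 1 : ℕ) : ℤ) + 1 = q - m by push_cast; ring] at h0
    rw [Finset.sum_range_succ, map_add, ih (by push_cast at hm; omega), dTot,
      LinearMap.add_apply, add_left_comm, h0, add_zero]

/-- If `ℰ^{p,q}_s` is empty, with `s ≥ 1`, then `d_s` vanishes on `E^{p,q}_s`. -/
lemma dr_eq_zero_of_scrE_eq_empty {p q s : ℤ} (hs : 1 ≤ s) (h : C.scrE p q s = ∅) :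
    C.dr p q s = 0 := by
  rw [dr_eq_zero_iff]
  intro x hx
  obtain ⟨n, rfl⟩ : ∃ n : ℕ, s = n + 1 := ⟨(s - 1).toNat, by omega⟩
  have hn : ((n : ℤ) + 1).toNat = n + 1 := by omega
  have hx0 := C.sub_proj_mem_F hx.1
  set c : ℕ → V := fun i => C.proj (p + i) (q - i) x with hc
  have hcA : ∀ i : ℕ, c i ∈ C.A (p + i) (q - i) := fun i => C.proj_mem _ _ _
  have hc0 : c 0 = C.proj p q x := by simp [hc]
  rw [← hc0] at hx0
  have hd : C.dTot (∑ i ∈ Finset.range (n + 1), c i) = C.d' (c n) :=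
    C.dTot_sum_proj hx n (by omega)
  by_cases hη : ∃ η, η ∈ C.F p (p + q) ∧ C.dTot η = 0 ∧ η - c 0 ∈ C.F (p + 1) (p + q)
  · obtain ⟨η, hηF, hηd, hη0⟩ := hη
    refine ⟨η, C.mem_Z.2 ⟨hηF, by rw [hηd]; exact zero_mem _⟩, ?_⟩
    rw [← sub_sub_sub_cancel_right η x (c 0)]
    exact sub_mem hη0 hx0
  have him : C.d' (c n) ∈ LinearMap.range C.d'' := by
    by_contra him
    rw [scrE, if_pos hs, Set.eq_empty_iff_forall_notMem] at h
    refine h _ ⟨c, hcA, rfl, ?_, ?_, hη⟩ <;> rw [hn, Nat.add_sub_cancel]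
    · exact hd
    · exact him
  obtain ⟨w, hw⟩ := him
  have hdn : C.d' (c n) ∈ C.A (p + n + 1) (q - n - 1 + 1) := by
    rw [sub_add_cancel]
    exact C.d'_mem (hcA n)
  have hwA := C.proj_mem (p + n + 1) (q - n - 1) w
  have hw' : C.d'' (C.proj (p + n + 1) (q - n - 1) w) = C.d' (c n) := by
    rw [← proj_d'', hw, C.proj_of_mem hdn]
  set v := C.proj (p + n + 1) (q - n - 1) w
  have hvF : v ∈ C.F (p + 1) (p + q) := C.A_le_F (by omega) (by ring) hwA
  have hlead : ∑ i ∈ Finset.range (n + 1), c i - c 0 ∈ C.F (p + 1) (p + q) := by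
    rw [Finset.sum_range_succ', add_sub_cancel_right]
    exact sum_mem fun i _ => C.A_le_F (by push_cast; omega) (by ring) (hcA (i + 1))
  have hyx : ∑ i ∈ Finset.range (n + 1), c i - v - x ∈ C.F (p + 1) (p + q) := by
    rw [sub_right_comm, ← sub_sub_sub_cancel_right _ x (c 0)]
    exact sub_mem (sub_mem hlead hx0) hvF
  refine ⟨∑ i ∈ Finset.range (n + 1), c i - v, C.mem_Z.2 ⟨?_, ?_⟩, hyx⟩
  · rw [← sub_add_cancel (∑ i ∈ Finset.range (n + 1), c i - v) x]
    exact add_mem (C.F_antitone (by omega) _ hyx) hx.1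
  · rw [map_sub, hd, dTot, LinearMap.add_apply, hw', sub_add_cancel_right]
    exact neg_mem (C.A_le_F (by omega) (by ring) (C.d'_mem hwA))

/-- The differential `d_0` vanishes on `E^{p,q}_0` if and only if `ℰ^{p,q}_0` is empty. -/
lemma dr_zero_eq_zero_iff (p q : ℤ) : C.dr p q 0 = 0 ↔ C.scrE p q 0 = ∅ := by
  rw [scrE, if_neg (by omega), Set.sdiff_eq_empty, SetLike.coe_subset_coe, dr_eq_zero_iff]
  have e1 : p + (q + 1) = p + q + 1 := by ring
  have e2 : p + (q + 1) - 1 = p + q := by ring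
  have e3 : p + 1 + q = p + q + 1 := by ring
  constructor
  · rintro h _ ⟨hF, x, hx, rfl⟩
    rw [SetLike.mem_coe, e1] at hF
    rw [SetLike.mem_coe, sub_zero, e2] at hx
    obtain ⟨y, hy, hyx⟩ := h x (C.mem_Z.2 ⟨hx, by rwa [add_zero]⟩)
    have hdy := (C.mem_Z.1 hy).2
    rw [zero_add] at hdy
    rw [show C.dTot x = C.dTot y + C.dTot (x - y) by simp]
    refine add_mem (mem_sup_left (C.mem_Z.2 ⟨by rwa [e3], ?_⟩))
      (mem_sup_right (C.mem_B.2 ⟨?_, x - y, ?_, rfl⟩))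
    · rw [C.dd_apply]
      exact zero_mem _
    · rw [map_sub, e1]
      exact sub_mem hF (C.F_antitone (by omega) _ hdy)
    · rw [e2, sub_neg_eq_add, ← neg_sub]
      exact neg_mem hyx
  · intro h x hxZ
    obtain ⟨hx, hdx⟩ := C.mem_Z.1 hxZ
    rw [add_zero] at hdx
    have hmem := h (x := C.dTot x)
      (C.mem_B.2 ⟨by rwa [e1], x, by rwa [sub_zero, e2], rfl⟩)
    obtain ⟨y, hy, v, hv, hxy⟩ := mem_sup.1 hmem
    obtain ⟨-, w, hw, rfl⟩ := C.mem_B.1 hv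
    rw [e2, sub_neg_eq_add] at hw
    replace hy := (C.mem_Z.1 hy).1
    rw [e3] at hy
    refine ⟨x - w, C.mem_Z.2 ⟨sub_mem hx (C.F_antitone (by omega) _ hw), ?_⟩,
      by simpa using hw⟩
    rw [map_sub, ← hxy, add_sub_cancel_right, zero_add]
    exact hy

/-- The spectral sequence degenerates at `E_r`, `r ≥ 1`, if and only if all the sets
`ℰ^{p,q}_s` with `s ≥ r` are empty. -/
lemma dr_eq_zero_iff_scrE_eq_empty {r : ℤ} (hr : 1 ≤ r) :
    (∀ p q s : ℤ, r ≤ s → C.dr p q s = 0) ↔ ∀ p q s : ℤ, r ≤ s → C.scrE p q s = ∅ :=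
  ⟨fun h p q _ hs => C.scrE_eq_empty_of_dr_eq_zero (hr.trans hs)
      fun t ht => h p q t (hs.trans ht),
    fun h p q s hs => C.dr_eq_zero_of_scrE_eq_empty (hr.trans hs) (h p q s hs)⟩

theorem statement_14 (r : ℤ) (hr : 1 ≤ r) :
    ((∀ p q s : ℤ, r ≤ s → C.dr p q s = 0) ∧ ∃ p q : ℤ, C.dr p q (r - 1) ≠ 0) ↔
      ((∀ p q s : ℤ, r ≤ s → C.scrE p q s = ∅) ∧ ∃ p q : ℤ, C.scrE p q (r - 1) ≠ ∅) := by
  rw [C.dr_eq_zero_iff_scrE_eq_empty hr]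
  refine and_congr_right fun h => ?_
  simp only [ne_eq, ← not_forall]
  rw [not_iff_not]
  obtain rfl | hr' := hr.eq_or_lt
  · rw [sub_self]
    exact forall₂_congr C.dr_zero_eq_zero_iff
  · refine forall₂_congr fun p q => ⟨fun h0 => ?_, C.dr_eq_zero_of_scrE_eq_empty (by omega)⟩
    refine C.scrE_eq_empty_of_dr_eq_zero (by omega) fun t ht => ?_
    obtain rfl | ht' := ht.eq_or_lt
    · exact h0
    · exact C.dr_eq_zero_of_scrE_eq_empty (by omega) (h p q t (by omega))

end DoubleComplex
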